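/- Let F be an algebraically closed field of characteristic 0, let V be an F-vector space with dim V ≥ 2, let n ≥ 2 and let ξ ∈ F be a primitive n-th root of unity. Suppose x, y ∈ End_F(V) satisfy: x^n and y^n are nonzero scalar multiples of the identity, and x y = ξ y x. Then the n² elements x^i y^j, 0 ≤ i, j ≤ n−1, are linearly independent over F, and the unital subalgebra S of End_F(V) generated by x and y is a simple associative algebra of dimension n² (isomorphic to M_n(F)). Moreover, the subgroup of the automorphism group of the algebra End_F(V) generated by the conjugation automorphisms Ad_x and Ad_y (where Ad_a(b) = a b a⁻¹) is isomorphic to ℤ_n × ℤ_n. -/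

import Mathlib

/-- The inner automorphism `Ad_u : b ↦ u b u⁻¹` of an algebra, attached to a unit `u`. -/
noncomputable def adAut (F A : Type*) [CommRing F] [Ring A] [Algebra F A] (u : Aˣ) :
    A ≃ₐ[F] A :=
  MulSemiringAction.toAlgAut (ConjAct Aˣ) F A (ConjAct.toConjAct u)

section Helpers

variable {F A : Type*} [Field F] [Ring A] [Algebra F A]

theorem qp_comm_pow {ξ : F} {x y : A} (h : x * y = ξ • (y * x)) (j : ℕ) :
    x * y ^ j = ξ ^ j • (y ^ j * x) := by
  induction j with
  | zero => simp
  | succ k ih =>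
    rw [pow_succ, ← mul_assoc, ih, smul_mul_assoc, mul_assoc, h, mul_smul_comm, smul_smul,
      ← pow_succ, mul_assoc]

theorem qp_comm_symm {ξ : F} (hξ : ξ ≠ 0) {x y : A} (h : x * y = ξ • (y * x)) :
    y * x = ξ⁻¹ • (x * y) := by
  rw [h, smul_smul, inv_mul_cancel₀ hξ, one_smul]

theorem qp_isUnit {n : ℕ} (hn : n ≠ 0) {c : F} (hc : c ≠ 0) {x : A}
    (hx : x ^ n = c • (1 : A)) : IsUnit x := by
  have : IsUnit (x ^ n) := by
    rw [hx, ← Algebra.algebraMap_eq_smul_one]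
    exact (IsUnit.mk0 c hc).map (algebraMap F A)
  exact (isUnit_pow_iff hn).1 this

/-- the map `a ↦ x a x^(n-1)` -/
noncomputable def qpOp (F : Type*) {A : Type*} [Field F] [Ring A] [Algebra F A]
    (n : ℕ) (x : A) : Module.End F A :=
  (LinearMap.mulLeft F x).comp (LinearMap.mulRight F (x ^ (n - 1)))

theorem qpOp_eigen {n : ℕ} (hn : n ≠ 0) {c : F} {x : A}
    (hx : x ^ n = c • (1 : A)) {μ : F} {w : A} (hw : x * w = μ • (w * x)) :
    w ∈ (qpOp F n x).eigenspace (c * μ) := by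
  rw [Module.End.mem_eigenspace_iff]
  simp only [qpOp, LinearMap.comp_apply, LinearMap.mulLeft_apply, LinearMap.mulRight_apply]
  rw [← mul_assoc, hw, smul_mul_assoc, mul_assoc, ← pow_succ',
    Nat.sub_add_cancel (Nat.one_le_iff_ne_zero.2 hn), hx, mul_smul_comm, mul_one, smul_smul,
    mul_comm]

theorem qp_pow_inj {n : ℕ} {ξ : F} (hξ : IsPrimitiveRoot ξ n) {c : F} (hc : c ≠ 0) :
    Function.Injective (fun i : Fin n => c * ξ ^ (i : ℕ)) := by
  intro i j hij
  exact Fin.ext (hξ.pow_inj i.2 j.2 (mul_left_cancel₀ hc hij))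

theorem qp_linearIndependent [Nontrivial A] {n : ℕ} (hn : 2 ≤ n) {ξ : F}
    (hξ : IsPrimitiveRoot ξ n) {x y : A} {c d : F} (hc : c ≠ 0) (hd : d ≠ 0)
    (hx : x ^ n = c • (1 : A)) (hy : y ^ n = d • (1 : A)) (hcomm : x * y = ξ • (y * x)) :
    LinearIndependent F (fun p : Fin n × Fin n => x ^ (p.1 : ℕ) * y ^ (p.2 : ℕ)) := by
  have hn0 : n ≠ 0 := by omega
  have hξ0 : ξ ≠ 0 := hξ.ne_zero hn0
  have ux := qp_isUnit hn0 hc hx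
  have uy := qp_isUnit hn0 hd hy
  have hsymm := qp_comm_symm hξ0 hcomm
  have hLx : LinearIndependent F (fun i : Fin n => x ^ (i : ℕ)) :=
    Module.End.eigenvectors_linearIndependent' (qpOp F n y) _ (qp_pow_inj hξ.inv hd) _
      (fun i => ⟨qpOp_eigen hn0 hy (qp_comm_pow hsymm i), (ux.pow _).ne_zero⟩)
  rw [Fintype.linearIndependent_iff]
  intro a ha
  set w : Fin n → A := fun j => (∑ i : Fin n, a (i, j) • x ^ (i : ℕ)) * y ^ (j : ℕ) with hw
  have hsum : ∑ j, w j = 0 := by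
    rw [← ha, Fintype.sum_prod_type_right]
    refine Finset.sum_congr rfl fun j _ => ?_
    simp only [hw, Finset.sum_mul, smul_mul_assoc]
  have hmem : ∀ j : Fin n, w j ∈ (qpOp F n x).eigenspace (c * ξ ^ (j : ℕ)) := by
    intro j
    apply qpOp_eigen hn0 hx
    have hc1 : Commute x (∑ i : Fin n, a (i, j) • x ^ (i : ℕ)) :=
      Commute.sum_right _ _ _ fun i _ => ((Commute.refl x).pow_right _).smul_right _
    simp only [hw]
    rw [← mul_assoc, hc1.eq, mul_assoc, qp_comm_pow hcomm, mul_smul_comm, mul_assoc]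
  have hind := (qpOp F n x).eigenspaces_iSupIndep.comp (qp_pow_inj hξ hc)
  rw [iSupIndep_iff_finsetSum_eq_zero_imp_eq_zero] at hind
  rintro ⟨i, j⟩
  have hwj : w j = 0 := hind Finset.univ w (fun j _ => hmem j) hsum j (Finset.mem_univ j)
  have hz : (∑ i : Fin n, a (i, j) • x ^ (i : ℕ)) = 0 := (uy.pow _).mul_left_eq_zero.1 hwj
  exact Fintype.linearIndependent_iff.1 hLx (fun i => a (i, j)) hz i

theorem qp_mem_span {n : ℕ} (hn : 2 ≤ n) {x y : A} {c d : F}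
    (hx : x ^ n = c • (1 : A)) (hy : y ^ n = d • (1 : A)) (i j : ℕ) :
    x ^ i * y ^ j ∈ Submodule.span F
      (Set.range (fun p : Fin n × Fin n => x ^ (p.1 : ℕ) * y ^ (p.2 : ℕ))) := by
  have hn0 : 0 < n := by omega
  have key : ∀ (z : A) (e : F), z ^ n = e • (1 : A) → ∀ k, z ^ k = e ^ (k / n) • z ^ (k % n) := by
    intro z e hz k
    conv_lhs => rw [← Nat.div_add_mod k n]
    rw [pow_add, pow_mul, hz, smul_pow, one_pow, smul_mul_assoc, one_mul]
  rw [key x c hx i, key y d hy j, smul_mul_smul_comm]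
  exact Submodule.smul_mem _ _ (Submodule.subset_span
    ⟨(⟨i % n, Nat.mod_lt _ hn0⟩, ⟨j % n, Nat.mod_lt _ hn0⟩), rfl⟩)

theorem qp_span {n : ℕ} (hn : 2 ≤ n) {ξ : F} (hξ : ξ ≠ 0) {x y : A} {c d : F}
    (hx : x ^ n = c • (1 : A)) (hy : y ^ n = d • (1 : A)) (hcomm : x * y = ξ • (y * x)) :
    Subalgebra.toSubmodule (Algebra.adjoin F ({x, y} : Set A)) = Submodule.span F
      (Set.range (fun p : Fin n × Fin n => x ^ (p.1 : ℕ) * y ^ (p.2 : ℕ))) := by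
  set P := Submodule.span F
      (Set.range (fun p : Fin n × Fin n => x ^ (p.1 : ℕ) * y ^ (p.2 : ℕ))) with hP
  have hsymm := qp_comm_symm hξ hcomm
  apply le_antisymm
  · intro s hs
    have hs' : s ∈ Algebra.adjoin F ({x, y} : Set A) := hs
    have hgen : ∀ t : A, (∀ i j : ℕ, t * (x ^ i * y ^ j) ∈ P) → ∀ p ∈ P, t * p ∈ P := by
      intro t ht p hp
      induction hp using Submodule.span_induction with
      | mem z hz => obtain ⟨q, rfl⟩ := hz; exact ht _ _
      | zero => simp
      | add a b _ _ ha hb => rw [mul_add]; exact P.add_mem ha hb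
      | smul r a _ ha => rw [mul_smul_comm]; exact P.smul_mem _ ha
    have key : ∀ p ∈ P, s * p ∈ P := by
      induction hs' using Algebra.adjoin_induction with
      | mem z hz =>
        rcases hz with rfl | hz
        · apply hgen
          intro i j
          rw [← mul_assoc, ← pow_succ']
          exact qp_mem_span hn hx hy _ _
        · rw [Set.mem_singleton_iff] at hz
          subst hz
          apply hgen
          intro i j
          rw [← mul_assoc, qp_comm_pow hsymm, smul_mul_assoc, mul_assoc, ← pow_succ']
          exact P.smul_mem _ (qp_mem_span hn hx hy _ _)
      | algebraMap r =>
        intro p hp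
        rw [← Algebra.smul_def]
        exact P.smul_mem _ hp
      | add a b ha hb iha ihb =>
        intro p hp
        rw [add_mul]
        exact P.add_mem (iha ha p hp) (ihb hb p hp)
      | mul a b ha hb iha ihb =>
        intro p hp
        rw [mul_assoc]
        exact iha ha _ (ihb hb p hp)
    have h1 : (1 : A) ∈ P := by simpa using qp_mem_span hn hx hy 0 0
    simpa using key 1 h1
  · rw [hP, Submodule.span_le]
    rintro _ ⟨p, rfl⟩
    have hxm : x ∈ Algebra.adjoin F ({x, y} : Set A) := Algebra.subset_adjoin (by simp)
    have hym : y ∈ Algebra.adjoin F ({x, y} : Set A) := Algebra.subset_adjoin (by simp)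
    exact Subalgebra.mul_mem _ (Subalgebra.pow_mem _ hxm _) (Subalgebra.pow_mem _ hym _)

theorem qp_injective {B : Type*} [Ring B] [Algebra F B] [Nontrivial B]
    {n : ℕ} (hn : 2 ≤ n) {ξ : F}
    (hξ : IsPrimitiveRoot ξ n) {x y : A} {c d : F} (hc : c ≠ 0) (hd : d ≠ 0)
    (hx : x ^ n = c • (1 : A)) (hy : y ^ n = d • (1 : A)) (hcomm : x * y = ξ • (y * x))
    (f : ↥(Algebra.adjoin F ({x, y} : Set A)) →ₐ[F] B) (s) (hs : f s = 0) : s = 0 := by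
  have hxm : x ∈ Algebra.adjoin F ({x, y} : Set A) := Algebra.subset_adjoin (by simp)
  have hym : y ∈ Algebra.adjoin F ({x, y} : Set A) := Algebra.subset_adjoin (by simp)
  set X : ↥(Algebra.adjoin F ({x, y} : Set A)) := ⟨x, hxm⟩ with hX
  set Y : ↥(Algebra.adjoin F ({x, y} : Set A)) := ⟨y, hym⟩ with hY
  have hXn : X ^ n = c • 1 := Subtype.ext (by simpa [hX] using hx)
  have hYn : Y ^ n = d • 1 := Subtype.ext (by simpa [hY] using hy)
  have hXY : X * Y = ξ • (Y * X) := Subtype.ext (by simpa [hX, hY] using hcomm)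
  have hli := qp_linearIndependent (A := B) hn hξ hc hd (x := f X) (y := f Y)
    (by rw [← map_pow, hXn, map_smul, map_one]) (by rw [← map_pow, hYn, map_smul, map_one])
    (by rw [← map_mul, hXY, map_smul, map_mul])
  have hmem : (s : A) ∈ Subalgebra.toSubmodule (Algebra.adjoin F ({x, y} : Set A)) := s.2
  rw [qp_span hn (hξ.ne_zero (by omega)) hx hy hcomm,
    Submodule.mem_span_range_iff_exists_fun] at hmem
  obtain ⟨a, ha⟩ := hmem
  have hs2 : s = ∑ p : Fin n × Fin n, a p • (X ^ (p.1 : ℕ) * Y ^ (p.2 : ℕ)) := by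
    apply Subtype.ext
    rw [← ha]
    simp [hX, hY]
  have h0 : ∑ p : Fin n × Fin n, a p • ((f X) ^ (p.1 : ℕ) * (f Y) ^ (p.2 : ℕ)) = 0 := by
    rw [← hs, hs2]
    simp
  have haz := Fintype.linearIndependent_iff.1 hli a h0
  rw [hs2]
  simp [haz]

theorem qp_simple [Nontrivial A] {n : ℕ} (hn : 2 ≤ n) {ξ : F}
    (hξ : IsPrimitiveRoot ξ n) {x y : A} {c d : F} (hc : c ≠ 0) (hd : d ≠ 0)
    (hx : x ^ n = c • (1 : A)) (hy : y ^ n = d • (1 : A)) (hcomm : x * y = ξ • (y * x)) :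
    IsSimpleRing ↥(Algebra.adjoin F ({x, y} : Set A)) := by
  apply IsSimpleRing.of_eq_bot_or_eq_top
  intro I
  by_cases hI : (1 : ↥(Algebra.adjoin F ({x, y} : Set A))) ∈ I
  · right
    exact (TwoSidedIdeal.one_mem_iff I).1 hI
  · left
    have hnt : Nontrivial I.ringCon.Quotient := by
      refine ⟨⟨1, 0, fun h => hI ?_⟩⟩
      rw [TwoSidedIdeal.mem_iff]
      exact (RingCon.eq I.ringCon).1 h
    rw [eq_bot_iff]
    intro s hs
    rw [TwoSidedIdeal.mem_bot]
    refine qp_injective hn hξ hc hd hx hy hcomm (I.ringCon.mkₐ F) s ?_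
    rw [TwoSidedIdeal.mem_iff] at hs
    exact (RingCon.eq I.ringCon).2 hs

theorem qp_finrank [Nontrivial A] {n : ℕ} (hn : 2 ≤ n) {ξ : F}
    (hξ : IsPrimitiveRoot ξ n) {x y : A} {c d : F} (hc : c ≠ 0) (hd : d ≠ 0)
    (hx : x ^ n = c • (1 : A)) (hy : y ^ n = d • (1 : A)) (hcomm : x * y = ξ • (y * x)) :
    Module.finrank F ↥(Algebra.adjoin F ({x, y} : Set A)) = n ^ 2 := by
  have h := finrank_span_eq_card (qp_linearIndependent hn hξ hc hd hx hy hcomm)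
  rw [← qp_span hn (hξ.ne_zero (by omega)) hx hy hcomm] at h
  rw [← Subalgebra.finrank_toSubmodule, h]
  simp [sq]

theorem qp_matrix [IsAlgClosed F] [Nontrivial A] {n : ℕ} (hn : 2 ≤ n) {ξ : F}
    (hξ : IsPrimitiveRoot ξ n) {x y : A} {c d : F} (hc : c ≠ 0) (hd : d ≠ 0)
    (hx : x ^ n = c • (1 : A)) (hy : y ^ n = d • (1 : A)) (hcomm : x * y = ξ • (y * x)) :
    Nonempty (↥(Algebra.adjoin F ({x, y} : Set A)) ≃ₐ[F] Matrix (Fin n) (Fin n) F) := by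
  have hr := qp_finrank hn hξ hc hd hx hy hcomm
  have := qp_simple hn hξ hc hd hx hy hcomm
  have : FiniteDimensional F ↥(Algebra.adjoin F ({x, y} : Set A)) :=
    Module.finite_of_finrank_pos (by rw [hr]; positivity)
  obtain ⟨m, hm, ⟨e⟩⟩ := IsSimpleRing.exists_algEquiv_matrix_of_isAlgClosed F
    ↥(Algebra.adjoin F ({x, y} : Set A))
  have h := e.toLinearEquiv.finrank_eq
  rw [hr, Module.finrank_matrix] at h
  simp only [Fintype.card_fin, Module.finrank_self, mul_one] at h
  have hmn : m = n := by nlinarith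
  subst hmn
  exact ⟨e⟩

end Helpers

theorem qp_group {G : Type*} [Group G] {a b : G} {n : ℕ} (hab : Commute a b)
    (ha : a ^ n = 1) (hb : b ^ n = 1)
    (h : ∀ i j : ℤ, a ^ i * b ^ j = 1 → (n : ℤ) ∣ i ∧ (n : ℤ) ∣ j) :
    Nonempty ((Subgroup.closure {a, b} : Subgroup G) ≃* Multiplicative (ZMod n × ZMod n)) := by
  let T := Multiplicative (ZMod n × ZMod n)
  have hz : ∀ (g : G), g ^ n = 1 → ∀ i j : ℤ, (i : ZMod n) = (j : ZMod n) → g ^ i = g ^ j := by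
    intro g hg i j hij
    rw [ZMod.intCast_eq_intCast_iff_dvd_sub] at hij
    obtain ⟨k, hk⟩ := hij
    have : j = i + n * k := by omega
    rw [this, zpow_add, zpow_mul, zpow_natCast, hg, one_zpow, mul_one]
  have hadd : ∀ (g : G), g ^ n = 1 → ∀ s t : ZMod n,
      g ^ ((s + t).cast : ℤ) = g ^ (s.cast : ℤ) * g ^ (t.cast : ℤ) := by
    intro g hg s t
    rw [← zpow_add]
    apply hz g hg
    simp
  let φ : T →* G := MonoidHom.mk'
    (fun t => a ^ ((Multiplicative.toAdd t).1.cast : ℤ) * b ^ ((Multiplicative.toAdd t).2.cast : ℤ))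
    (by
      intro s t
      change a ^ (((Multiplicative.toAdd s).1 + (Multiplicative.toAdd t).1).cast : ℤ) *
        b ^ (((Multiplicative.toAdd s).2 + (Multiplicative.toAdd t).2).cast : ℤ) = _
      rw [hadd a ha, hadd b hb]
      have hc := (hab.zpow_zpow ((Multiplicative.toAdd t).1.cast : ℤ)
        ((Multiplicative.toAdd s).2.cast : ℤ)).eq
      simp only [mul_assoc]
      congr 1
      simp only [← mul_assoc]
      rw [hc])
  have hφ : ∀ i j : ℤ, φ (Multiplicative.ofAdd ((i : ZMod n), (j : ZMod n))) = a ^ i * b ^ j := by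
    intro i j
    change a ^ (((i : ZMod n)).cast : ℤ) * b ^ (((j : ZMod n)).cast : ℤ) = _
    rw [hz a ha _ i (by simp), hz b hb _ j (by simp)]
  have hinj : Function.Injective φ := by
    rw [injective_iff_map_eq_one]
    intro t ht
    obtain ⟨h1, h2⟩ := h _ _ ht
    rw [← ZMod.intCast_zmod_eq_zero_iff_dvd] at h1 h2
    apply Multiplicative.toAdd.injective
    refine Prod.ext ?_ ?_
    · simpa using h1
    · simpa using h2
  have hrange : φ.range = Subgroup.closure {a, b} := by
    apply le_antisymm
    · rintro _ ⟨t, rfl⟩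
      exact mul_mem (zpow_mem (Subgroup.subset_closure (by simp)) _)
        (zpow_mem (Subgroup.subset_closure (by simp)) _)
    · rw [Subgroup.closure_le]
      rintro g (rfl | hg)
      · exact ⟨_, by simpa using hφ 1 0⟩
      · rw [Set.mem_singleton_iff] at hg
        subst hg
        exact ⟨_, by simpa using hφ 0 1⟩
  exact ⟨((MonoidHom.ofInjective hinj).trans (MulEquiv.subgroupCongr hrange)).symm⟩

theorem adAut_apply (F A : Type*) [CommRing F] [Ring A] [Algebra F A] (u : Aˣ) (b : A) :
    adAut F A u b = u * b * (u⁻¹ : Aˣ) := rfl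

theorem qp_ad {F A : Type*} [Field F] [Ring A] [Nontrivial A] [Algebra F A]
    {n : ℕ} (hn : 2 ≤ n) {ξ : F}
    (hξ : IsPrimitiveRoot ξ n) {x y : Aˣ} {c d : F}
    (hx : (x : A) ^ n = c • (1 : A)) (hy : (y : A) ^ n = d • (1 : A))
    (hcomm : (x : A) * y = ξ • ((y : A) * x)) :
    Nonempty ((Subgroup.closure {adAut F A x, adAut F A y} : Subgroup (A ≃ₐ[F] A)) ≃*
        Multiplicative (ZMod n × ZMod n)) := by
  have hξ0 : ξ ≠ 0 := hξ.ne_zero (by omega)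
  have hsymm := qp_comm_symm hξ0 hcomm
  -- `adAut` as a group homomorphism
  let Φ : Aˣ →* (A ≃ₐ[F] A) := MonoidHom.mk' (adAut F A) (by
    intro u v
    ext b
    simp [adAut_apply, AlgEquiv.mul_apply, mul_assoc])
  have hΦ : ∀ u, Φ u = adAut F A u := fun _ => rfl
  have hscal : ∀ (u : Aˣ) (e : F), (u : A) = e • (1 : A) → Φ u = 1 := by
    intro u e hu
    ext b
    rw [hΦ, adAut_apply, AlgEquiv.one_apply]
    rw [Units.mul_inv_eq_iff_eq_mul, hu]
    simp
  have hxx : adAut F A x (x : A) = x := by simp [adAut_apply]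
  have hyy : adAut F A y (y : A) = y := by simp [adAut_apply]
  have hxy : adAut F A x (y : A) = ξ • (y : A) := by
    rw [adAut_apply, hcomm, Units.mul_inv_eq_iff_eq_mul, smul_mul_assoc]
  have hyx : adAut F A y (x : A) = ξ⁻¹ • (x : A) := by
    rw [adAut_apply, hsymm, Units.mul_inv_eq_iff_eq_mul, smul_mul_assoc]
  have hzp : ∀ (g : A ≃ₐ[F] A) (v : A) (μ : F), μ ≠ 0 → g v = μ • v →
      ∀ i : ℤ, (g ^ i) v = μ ^ i • v := by
    intro g v μ hμ hg i
    induction i using Int.induction_on with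
    | zero => simp
    | succ k ih =>
      rw [zpow_add_one, AlgEquiv.mul_apply, hg, map_smul, ih, smul_smul, zpow_add_one₀ hμ,
        mul_comm]
    | pred k ih =>
      have hg' : g⁻¹ v = μ⁻¹ • v := by
        apply g.injective
        rw [map_smul, hg, smul_smul, inv_mul_cancel₀ hμ, one_smul]
        exact g.apply_symm_apply v
      rw [zpow_sub_one, AlgEquiv.mul_apply, hg', map_smul, ih, smul_smul, zpow_sub_one₀ hμ,
        mul_comm]
  have hcm : Commute (adAut F A x) (adAut F A y) := by
    have h1 : Φ (x * y * (y * x)⁻¹) = 1 := by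
      apply hscal _ ξ
      rw [Units.val_mul, Units.mul_inv_eq_iff_eq_mul, Units.val_mul, hcomm]
      simp
    rw [map_mul, map_inv, mul_inv_eq_one, map_mul, map_mul] at h1
    exact h1
  have key : ∀ (v : A) (_ : v ≠ 0) (μ : F), μ • v = v → μ = 1 := by
    intro v hv μ h
    have h2 : (μ - 1) • v = 0 := by rw [sub_smul, one_smul, h, sub_self]
    exact sub_eq_zero.1 ((smul_eq_zero.1 h2).resolve_right hv)
  apply qp_group hcm
  · rw [← hΦ, ← map_pow]
    exact hscal _ c (by simpa using hx)
  · rw [← hΦ, ← map_pow]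
    exact hscal _ d (by simpa using hy)
  · intro i j hij
    constructor
    · have h1 := congrArg (fun g : A ≃ₐ[F] A => g (y : A)) hij
      simp only [AlgEquiv.mul_apply, AlgEquiv.one_apply] at h1
      rw [hzp _ _ 1 one_ne_zero (by rw [hyy, one_smul]) j, one_zpow, one_smul,
        hzp _ _ ξ hξ0 hxy i] at h1
      exact (hξ.zpow_eq_one_iff_dvd i).1 (key _ y.ne_zero _ h1)
    · have h1 := congrArg (fun g : A ≃ₐ[F] A => g (x : A)) hij
      simp only [AlgEquiv.mul_apply, AlgEquiv.one_apply] at h1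
      rw [hzp _ _ ξ⁻¹ (inv_ne_zero hξ0) hyx j, map_smul,
        hzp _ _ 1 one_ne_zero (by rw [hxx, one_smul]) i, one_zpow, one_smul] at h1
      exact (hξ.inv.zpow_eq_one_iff_dvd j).1 (key _ x.ne_zero _ h1)

theorem stmt11 (F V : Type) [Field F] [IsAlgClosed F] [CharZero F]
    [AddCommGroup V] [Module F V] (hV : 2 ≤ Module.rank F V)
    (n : ℕ) (hn : 2 ≤ n) (ξ : F) (hξ : IsPrimitiveRoot ξ n)
    (x y : Module.End F V) (c d : F) (hc : c ≠ 0) (hd : d ≠ 0)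
    (hx : x ^ n = c • (1 : Module.End F V)) (hy : y ^ n = d • (1 : Module.End F V))
    (hcomm : x * y = ξ • (y * x)) :
    LinearIndependent F (fun p : Fin n × Fin n => x ^ (p.1 : ℕ) * y ^ (p.2 : ℕ)) ∧
    IsSimpleRing ↥(Algebra.adjoin F ({x, y} : Set (Module.End F V))) ∧
    Module.finrank F ↥(Algebra.adjoin F ({x, y} : Set (Module.End F V))) = n ^ 2 ∧
    Nonempty (↥(Algebra.adjoin F ({x, y} : Set (Module.End F V))) ≃ₐ[F]
      Matrix (Fin n) (Fin n) F) ∧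
    ∀ ux uy : (Module.End F V)ˣ, (ux : Module.End F V) = x → (uy : Module.End F V) = y →
      Nonempty ((Subgroup.closure {adAut F (Module.End F V) ux, adAut F (Module.End F V) uy} :
          Subgroup ((Module.End F V) ≃ₐ[F] (Module.End F V))) ≃*
        Multiplicative (ZMod n × ZMod n)) := by
  have hnt : Nontrivial V := by
    rw [← rank_pos_iff_nontrivial (R := F)]
    exact lt_of_lt_of_le (by norm_num) hV
  refine ⟨qp_linearIndependent hn hξ hc hd hx hy hcomm, qp_simple hn hξ hc hd hx hy hcomm,
    qp_finrank hn hξ hc hd hx hy hcomm, qp_matrix hn hξ hc hd hx hy hcomm, ?_⟩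
  rintro ux uy rfl rfl
  exact qp_ad hn hξ hx hy hcomm
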